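/- For every n ∈ ℤ∖{0}: (i) for every f ∈ 𝒞, L_{n,+}^{−1}f ∈ 𝒞 with lim_{β→0+} L_{n,+}^{−1}f(β) = f(0)/(|n|μ + 2μ − 1) and lim_{β→∞} L_{n,+}^{−1}f(β) = 0; (ii) there is a constant C = C(μ, δ, η), independent of n, such that for every f ∈ 𝒞^δ, L_{n,+}^{−1}f ∈ 𝒞^δ_0 and ‖L_{n,+}^{−1}f‖_{𝒞^δ} ≤ C|n|^{−1}‖f‖_{𝒞^δ}. -/

import Mathlib

open Filter Topology Set MeasureTheory intervalIntegral

/-- sup norm over `[0,∞)`. -/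
noncomputable def supN (f : ℝ → ℂ) : ℝ := ⨆ β : Ici (0 : ℝ), ‖f (β : ℝ)‖

/-- sup norm over `(0,∞)`. -/
noncomputable def supNIoi (f : ℝ → ℂ) : ℝ := ⨆ β : Ioi (0 : ℝ), ‖f (β : ℝ)‖

/-- weighted seminorm `sup_{β>0} β^δ ‖f(β) − L‖`. -/
noncomputable def hoel (δ : ℝ) (f : ℝ → ℂ) (L : ℂ) : ℝ :=
  ⨆ β : Ioi (0 : ℝ), (β : ℝ) ^ δ * ‖f (β : ℝ) - L‖

/-- `a_n(β) = √(n²μ² − (2μ−1)η(β))`. -/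
noncomputable def aFun (μ : ℝ) (η : ℝ → ℝ) (n : ℤ) (β : ℝ) : ℝ :=
  Real.sqrt ((n : ℝ) ^ 2 * μ ^ 2 - (2 * μ - 1) * η β)

/-- `W_n(β) = exp(∫_1^β a_n(b)/b db)`. -/
noncomputable def WFun (μ : ℝ) (η : ℝ → ℝ) (n : ℤ) (β : ℝ) : ℝ :=
  Real.exp (∫ b in (1 : ℝ)..β, aFun μ η n b / b)

/-- `L_{n,+}^{-1} f (β) = β^{2μ-1} W_n(β) ∫_β^∞ b^{-2μ} W_n(b)^{-1} e^{in(β-b)} f(b) db`. -/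
noncomputable def Lplus (μ : ℝ) (η : ℝ → ℝ) (n : ℤ) (f : ℝ → ℂ) (β : ℝ) : ℂ :=
  ((β ^ (2 * μ - 1) * WFun μ η n β : ℝ) : ℂ) *
    ∫ b in Ioi β, ((b ^ (-(2 * μ)) / WFun μ η n b : ℝ) : ℂ) *
      Complex.exp (Complex.I * (n : ℂ) * ((β : ℂ) - (b : ℂ))) * f b

theorem continuous_aFun {μ : ℝ} {η : ℝ → ℝ} (hη : Continuous η) (n : ℤ) :
    Continuous (aFun μ η n) := by
  unfold aFun
  fun_prop

theorem le_aFun {μ : ℝ} {η : ℝ → ℝ} (hμ : 1 < μ) {n : ℤ} (hn : n ≠ 0) {β : ℝ} (hη : η β ≤ 1) :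
    |(n : ℝ)| * (μ - 1) ≤ aFun μ η n β := by
  have hn1 : (1 : ℝ) ≤ (n : ℝ) ^ 2 := by
    exact_mod_cast (sq_pos_of_ne_zero hn : 0 < n ^ 2)
  apply Real.le_sqrt_of_sq_le
  rw [mul_pow, sq_abs]
  nlinarith [mul_le_mul_of_nonneg_left hη (by linarith : (0 : ℝ) ≤ 2 * μ - 1),
    mul_le_mul_of_nonneg_left hn1 (by linarith : (0 : ℝ) ≤ 2 * μ - 1)]

theorem aFun_eq_of_eta_eq_zero {μ : ℝ} {η : ℝ → ℝ} (hμ : 0 ≤ μ) (n : ℤ) {β : ℝ} (hη : η β = 0) :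
    aFun μ η n β = |(n : ℝ)| * μ := by
  rw [aFun, hη, mul_zero, sub_zero, ← mul_pow, Real.sqrt_sq_eq_abs, abs_mul, abs_of_nonneg hμ]

theorem intervalIntegrable_aFun_div {μ : ℝ} {η : ℝ → ℝ} (hη : Continuous η) (n : ℤ) {x y : ℝ}
    (hx : 0 < x) (hy : 0 < y) :
    IntervalIntegrable (fun b => aFun μ η n b / b) volume x y := by
  apply ContinuousOn.intervalIntegrable
  refine (continuous_aFun hη n).continuousOn.div continuousOn_id fun b hb => ?_
  exact ((lt_min hx hy).trans_le hb.1).ne'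

theorem WFun_pos (μ : ℝ) (η : ℝ → ℝ) (n : ℤ) (β : ℝ) : 0 < WFun μ η n β := Real.exp_pos _

theorem hasDerivAt_WFun {μ : ℝ} {η : ℝ → ℝ} (hη : Continuous η) (n : ℤ) {β : ℝ} (hβ : 0 < β) :
    HasDerivAt (WFun μ η n) (WFun μ η n β * (aFun μ η n β / β)) β := by
  have hcont : ContinuousOn (fun b => aFun μ η n b / b) (Ioi 0) :=
    (continuous_aFun hη n).continuousOn.div continuousOn_id fun b hb => (ne_of_gt hb)
  exact (integral_hasDerivAt_right (intervalIntegrable_aFun_div hη n one_pos hβ)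
    (hcont.stronglyMeasurableAtFilter isOpen_Ioi β hβ)
    (hcont.continuousAt (Ioi_mem_nhds hβ))).exp

theorem continuousOn_WFun {μ : ℝ} {η : ℝ → ℝ} (hη : Continuous η) (n : ℤ) :
    ContinuousOn (WFun μ η n) (Ioi 0) := fun _ hβ =>
  (hasDerivAt_WFun hη n hβ).continuousAt.continuousWithinAt

theorem WFun_div_WFun {μ : ℝ} {η : ℝ → ℝ} (hη : Continuous η) (n : ℤ) {x y : ℝ}
    (hx : 0 < x) (hy : 0 < y) :
    WFun μ η n x / WFun μ η n y = Real.exp (-∫ b in x..y, aFun μ η n b / b) := by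
  rw [WFun, WFun, ← Real.exp_sub, ← integral_interval_sub_left
    (intervalIntegrable_aFun_div hη n one_pos hy) (intervalIntegrable_aFun_div hη n one_pos hx),
    neg_sub]

theorem integral_const_div {c β t : ℝ} (hβ : 0 < β) (ht : 1 ≤ t) :
    ∫ b in β..(β * t), c / b = c * Real.log t := by
  have ht0 : 0 < t := by linarith
  simp_rw [div_eq_mul_inv]
  rw [intervalIntegral.integral_const_mul, integral_inv_of_pos hβ (by positivity),
    mul_div_cancel_left₀ _ hβ.ne']

theorem WFun_div_WFun_le {μ : ℝ} {η : ℝ → ℝ} (hη : Continuous η) (n : ℤ) {c : ℝ}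
    (hc : ∀ b, c ≤ aFun μ η n b) {β t : ℝ} (hβ : 0 < β) (ht : 1 ≤ t) :
    WFun μ η n β / WFun μ η n (β * t) ≤ t ^ (-c) := by
  have ht0 : 0 < t := by linarith
  have hβt : 0 < β * t := by positivity
  have hle : β ≤ β * t := le_mul_of_one_le_right hβ.le ht
  rw [WFun_div_WFun hη n hβ hβt, Real.rpow_def_of_pos ht0, Real.exp_le_exp, mul_neg,
    neg_le_neg_iff, mul_comm, ← integral_const_div hβ ht]
  refine integral_mono_on hle ?_ (intervalIntegrable_aFun_div hη n hβ hβt) fun b hb => ?_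
  · refine ContinuousOn.intervalIntegrable (continuousOn_const.div continuousOn_id fun b hb => ?_)
    exact ((lt_min hβ hβt).trans_le hb.1).ne'
  · have := hβ.trans_le hb.1
    gcongr
    exact hc b

theorem WFun_div_WFun_eq {μ : ℝ} {η : ℝ → ℝ} (hμ : 0 ≤ μ) (hη : Continuous η)
    (hη0 : ∀ β ≤ 1, η β = 0) (n : ℤ) {β t : ℝ} (hβ : 0 < β) (ht : 1 ≤ t) (hβt : β * t ≤ 1) :
    WFun μ η n β / WFun μ η n (β * t) = t ^ (-(|(n : ℝ)| * μ)) := by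
  have ht0 : 0 < t := by linarith
  have hle : β ≤ β * t := le_mul_of_one_le_right hβ.le ht
  rw [WFun_div_WFun hη n hβ (by positivity), Real.rpow_def_of_pos ht0, mul_neg,
    mul_comm (Real.log t), ← integral_const_div hβ ht]
  congr 2
  refine integral_congr fun b hb => ?_
  rw [uIcc_of_le hle] at hb
  simp only [aFun_eq_of_eta_eq_zero hμ n (hη0 b (hb.2.trans hβt))]

/-- The kernel of `Lplus` in the scaled variable `t = b / β`. -/
noncomputable def scaledKernel (μ : ℝ) (η : ℝ → ℝ) (n : ℤ) (β t : ℝ) : ℝ :=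
  t ^ (-(2 * μ)) * (WFun μ η n β / WFun μ η n (β * t))

/-- The oscillating integrand of `Lplus` in the scaled variable `t = b / β`. -/
noncomputable def scaledIntegrand (μ : ℝ) (η : ℝ → ℝ) (n : ℤ) (f : ℝ → ℂ) (β t : ℝ) : ℂ :=
  (scaledKernel μ η n β t : ℂ) * Complex.exp (((n : ℝ) * (β * (1 - t)) : ℝ) * Complex.I) *
    f (β * t)

theorem Lplus_eq_integral (μ : ℝ) (η : ℝ → ℝ) (n : ℤ) (f : ℝ → ℂ) {β : ℝ} (hβ : 0 < β) :
    Lplus μ η n f β = ∫ t in Ioi (1 : ℝ), scaledIntegrand μ η n f β t := by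
  have h := integral_comp_mul_left_Ioi (fun b : ℝ => ((b ^ (-(2 * μ)) / WFun μ η n b : ℝ) : ℂ) *
      Complex.exp (Complex.I * (n : ℂ) * ((β : ℂ) - (b : ℂ))) * f b) 1 hβ
  rw [mul_one] at h
  have h' : ∫ b in Ioi β, ((b ^ (-(2 * μ)) / WFun μ η n b : ℝ) : ℂ) *
      Complex.exp (Complex.I * (n : ℂ) * ((β : ℂ) - (b : ℂ))) * f b =
      (β : ℂ) * ∫ t in Ioi (1 : ℝ), (((β * t) ^ (-(2 * μ)) / WFun μ η n (β * t) : ℝ) : ℂ) *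
      Complex.exp (Complex.I * (n : ℂ) * ((β : ℂ) - ((β * t : ℝ) : ℂ))) * f (β * t) := by
    rw [h, Complex.real_smul, ← mul_assoc, Complex.ofReal_inv,
      mul_inv_cancel₀ (by exact_mod_cast hβ.ne'), one_mul]
  rw [Lplus, h', ← mul_assoc, ← MeasureTheory.integral_const_mul]
  refine setIntegral_congr_fun measurableSet_Ioi fun t ht => ?_
  have ht0 : (0 : ℝ) < t := zero_lt_one.trans ht
  have hpow : β ^ (2 * μ - 1) * β * β ^ (-(2 * μ)) = 1 := by
    rw [← Real.rpow_add_one hβ.ne', ← Real.rpow_add hβ]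
    simp
  have hk : β ^ (2 * μ - 1) * WFun μ η n β * β * ((β * t) ^ (-(2 * μ)) / WFun μ η n (β * t)) =
      scaledKernel μ η n β t := by
    rw [scaledKernel, Real.mul_rpow hβ.le ht0.le]
    linear_combination (t ^ (-(2 * μ)) * (WFun μ η n β / WFun μ η n (β * t))) * hpow
  have he : Complex.I * (n : ℂ) * ((β : ℂ) - ((β * t : ℝ) : ℂ)) =
      (((n : ℝ) * (β * (1 - t)) : ℝ) : ℂ) * Complex.I := by
    push_cast
    ring
  simp only [scaledIntegrand, ← hk, he]
  push_cast
  ring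

theorem scaledKernel_nonneg (μ : ℝ) (η : ℝ → ℝ) (n : ℤ) (β : ℝ) {t : ℝ} (ht : 0 ≤ t) :
    0 ≤ scaledKernel μ η n β t :=
  mul_nonneg (Real.rpow_nonneg ht _) (div_nonneg (WFun_pos ..).le (WFun_pos ..).le)

theorem scaledKernel_le {μ : ℝ} {η : ℝ → ℝ} (hη : Continuous η) (n : ℤ) {c : ℝ}
    (hc : ∀ b, c ≤ aFun μ η n b) {β t : ℝ} (hβ : 0 < β) (ht : 1 ≤ t) :
    scaledKernel μ η n β t ≤ t ^ (-(2 * μ) - c) := by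
  have ht0 : 0 < t := by linarith
  rw [scaledKernel, sub_eq_add_neg, Real.rpow_add ht0]
  exact mul_le_mul_of_nonneg_left (WFun_div_WFun_le hη n hc hβ ht) (Real.rpow_nonneg ht0.le _)

theorem norm_scaledIntegrand (μ : ℝ) (η : ℝ → ℝ) (n : ℤ) (f : ℝ → ℂ) (β : ℝ) {t : ℝ}
    (ht : 0 ≤ t) :
    ‖scaledIntegrand μ η n f β t‖ = scaledKernel μ η n β t * ‖f (β * t)‖ := by
  rw [scaledIntegrand, norm_mul, norm_mul, Complex.norm_exp_ofReal_mul_I, mul_one,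
    Complex.norm_of_nonneg (scaledKernel_nonneg μ η n β ht)]

theorem hasDerivAt_scaledKernel {μ : ℝ} {η : ℝ → ℝ} (hη : Continuous η) (n : ℤ) {β t : ℝ}
    (hβ : 0 < β) (ht : 0 < t) :
    HasDerivAt (scaledKernel μ η n β)
      (-((2 * μ + aFun μ η n (β * t)) / t * scaledKernel μ η n β t)) t := by
  have hW : HasDerivAt (fun s => WFun μ η n (β * s))
      (WFun μ η n (β * t) * (aFun μ η n (β * t) / (β * t)) * (β * 1)) t :=
    (hasDerivAt_WFun hη n (mul_pos hβ ht)).comp t ((hasDerivAt_id t).const_mul β)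
  have h := (Real.hasDerivAt_rpow_const (p := -(2 * μ)) (Or.inl ht.ne')).mul
    ((hasDerivAt_const t (WFun μ η n β)).div hW (WFun_pos ..).ne')
  refine h.congr_deriv ?_
  have := (WFun_pos μ η n (β * t)).ne'
  rw [scaledKernel, Real.rpow_sub_one ht.ne']
  simp only [Pi.div_apply]
  field_simp
  ring

theorem scaledKernel_one (μ : ℝ) (η : ℝ → ℝ) (n : ℤ) (β : ℝ) : scaledKernel μ η n β 1 = 1 := by
  rw [scaledKernel, mul_one, Real.one_rpow, div_self (WFun_pos ..).ne', one_mul]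

theorem continuousOn_scaledIntegrand_right {μ : ℝ} {η : ℝ → ℝ} (hη : Continuous η) (n : ℤ)
    {f : ℝ → ℂ} (hf : ContinuousOn f (Ici 0)) {β : ℝ} (hβ : 0 < β) :
    ContinuousOn (scaledIntegrand μ η n f β) (Ioi 1) := by
  have hk : ContinuousOn (scaledKernel μ η n β) (Ioi 1) := fun t ht =>
    (hasDerivAt_scaledKernel hη n hβ (zero_lt_one.trans ht)).continuousAt.continuousWithinAt
  refine ((Complex.continuous_ofReal.comp_continuousOn hk).mul
    (Continuous.continuousOn (by fun_prop))).mul ?_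
  exact hf.comp (by fun_prop) fun t ht => (mul_pos hβ (zero_lt_one.trans ht)).le

theorem continuousOn_scaledIntegrand_left {μ : ℝ} {η : ℝ → ℝ} (hη : Continuous η) (n : ℤ)
    {f : ℝ → ℂ} (hf : ContinuousOn f (Ici 0)) {t : ℝ} (ht : 0 < t) :
    ContinuousOn (fun β => scaledIntegrand μ η n f β t) (Ioi 0) := by
  have hmaps : MapsTo (fun β : ℝ => β * t) (Ioi 0) (Ioi 0) := fun β hβ => mul_pos hβ ht
  have hk : ContinuousOn (fun β => scaledKernel μ η n β t) (Ioi 0) :=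
    continuousOn_const.mul ((continuousOn_WFun hη n).div
      ((continuousOn_WFun hη n).comp (by fun_prop) hmaps) fun β _ => (WFun_pos ..).ne')
  refine ((Complex.continuous_ofReal.comp_continuousOn hk).mul
    (Continuous.continuousOn (by fun_prop))).mul ?_
  exact hf.comp (by fun_prop) fun β hβ => Ioi_subset_Ici_self (hmaps hβ)

theorem norm_scaledIntegrand_le {μ : ℝ} {η : ℝ → ℝ} (hη : Continuous η) (n : ℤ) {c : ℝ}
    (hc : ∀ b, c ≤ aFun μ η n b) {f : ℝ → ℂ} {β M : ℝ} (hβ : 0 < β)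
    (hM : ∀ b, β ≤ b → ‖f b‖ ≤ M) {t : ℝ} (ht : 1 ≤ t) :
    ‖scaledIntegrand μ η n f β t‖ ≤ t ^ (-(2 * μ) - c) * M := by
  have ht0 : 0 ≤ t := by linarith
  rw [norm_scaledIntegrand μ η n f β ht0]
  exact mul_le_mul (scaledKernel_le hη n hc hβ ht) (hM _ (le_mul_of_one_le_right hβ.le ht))
    (norm_nonneg _) (Real.rpow_nonneg ht0 _)

theorem integrableOn_scaledIntegrand {μ : ℝ} {η : ℝ → ℝ} (hη : Continuous η) (n : ℤ) {c : ℝ}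
    (hc : ∀ b, c ≤ aFun μ η n b) (hcμ : 1 < 2 * μ + c) {f : ℝ → ℂ}
    (hf : ContinuousOn f (Ici 0)) {β M : ℝ} (hβ : 0 < β) (hM : ∀ b, β ≤ b → ‖f b‖ ≤ M) :
    IntegrableOn (scaledIntegrand μ η n f β) (Ioi 1) := by
  refine ((integrableOn_Ioi_rpow_of_lt (by linarith : -(2 * μ) - c < -1) one_pos).mul_const M).mono'
    ((continuousOn_scaledIntegrand_right hη n hf hβ).aestronglyMeasurable measurableSet_Ioi) ?_
  filter_upwards [ae_restrict_mem measurableSet_Ioi] with t ht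
  exact norm_scaledIntegrand_le hη n hc hβ hM (le_of_lt ht)

theorem norm_Lplus_le {μ : ℝ} {η : ℝ → ℝ} (hη : Continuous η) (n : ℤ) {c : ℝ}
    (hc : ∀ b, c ≤ aFun μ η n b) (hcμ : 1 < 2 * μ + c) {f : ℝ → ℂ} {β M : ℝ} (hβ : 0 < β)
    (hM : ∀ b, β ≤ b → ‖f b‖ ≤ M) :
    ‖Lplus μ η n f β‖ ≤ M / (2 * μ + c - 1) := by
  have hlt : -(2 * μ) - c < -1 := by linarith
  rw [Lplus_eq_integral μ η n f hβ]
  refine (MeasureTheory.norm_integral_le_of_norm_le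
    ((integrableOn_Ioi_rpow_of_lt hlt one_pos).mul_const M) ?_).trans_eq ?_
  · filter_upwards [ae_restrict_mem measurableSet_Ioi] with t ht
    exact norm_scaledIntegrand_le hη n hc hβ hM (le_of_lt ht)
  · rw [MeasureTheory.integral_mul_const, integral_Ioi_rpow_of_lt hlt one_pos, Real.one_rpow,
      show -(2 * μ) - c + 1 = -(2 * μ + c - 1) by ring, neg_div_neg_eq, one_div_mul_eq_div]

theorem Lplus_eq_add {μ : ℝ} {η : ℝ → ℝ} (hη : Continuous η) (n : ℤ) {c : ℝ}
    (hc : ∀ b, c ≤ aFun μ η n b) (hcμ : 1 < 2 * μ + c) {f : ℝ → ℂ}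
    (hf : ContinuousOn f (Ici 0)) {β M : ℝ} (hβ : 0 < β) (hM : ∀ b, β ≤ b → ‖f b‖ ≤ M) (L : ℂ) :
    Lplus μ η n f β = Lplus μ η n (fun b => f b - L) β + L * Lplus μ η n (fun _ => 1) β := by
  have h₁ := integrableOn_scaledIntegrand hη n hc hcμ (f := fun b => f b - L)
    (hf.sub continuousOn_const) hβ (M := M + ‖L‖)
    fun b hb => (norm_sub_le _ _).trans (add_le_add_left (hM b hb) _)
  have h₂ := integrableOn_scaledIntegrand hη n hc hcμ (f := fun _ => 1) continuousOn_const hβ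
    (M := 1) fun b _ => by simp
  rw [Lplus_eq_integral _ _ _ _ hβ, Lplus_eq_integral _ _ _ _ hβ, Lplus_eq_integral _ _ _ _ hβ,
    ← MeasureTheory.integral_const_mul, ← MeasureTheory.integral_add h₁ (h₂.const_mul L)]
  refine MeasureTheory.integral_congr_ae (Eventually.of_forall fun t => ?_)
  simp only [scaledIntegrand]
  ring

theorem norm_Lplus_one_le {μ : ℝ} {η : ℝ → ℝ} (hμ : 0 ≤ μ) (hη : Continuous η) {n : ℤ}
    (hn : n ≠ 0) {c : ℝ} (hc : ∀ b, c ≤ aFun μ η n b) (hcμ : 1 < 2 * μ + c) {β : ℝ}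
    (hβ : 0 < β) :
    ‖Lplus μ η n (fun _ => 1) β‖ ≤ 2 * |(n : ℝ)|⁻¹ / β := by
  set k := scaledKernel μ η n β with hk
  set k' : ℝ → ℝ := fun t => -((2 * μ + aFun μ η n (β * t)) / t * k t) with hk'
  set e : ℝ → ℂ := fun t => Complex.exp (((n : ℝ) * (β * (1 - t)) : ℝ) * Complex.I) with he
  have hkd : ∀ t ∈ Ici (1 : ℝ), HasDerivAt k (k' t) t := fun t ht =>
    hasDerivAt_scaledKernel hη n hβ (zero_lt_one.trans_le ht)
  have hk'_nonpos : ∀ t ∈ Ioi (1 : ℝ), k' t ≤ 0 := fun t ht => by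
    have ht0 : (0 : ℝ) < t := zero_lt_one.trans ht
    have h₁ : 0 ≤ k t := scaledKernel_nonneg μ η n β ht0.le
    have h₂ : 0 ≤ aFun μ η n (β * t) := Real.sqrt_nonneg _
    simp only [hk', Left.neg_nonpos_iff]
    positivity
  have hk_lim : Tendsto k atTop (𝓝 0) := by
    refine tendsto_of_tendsto_of_tendsto_of_le_of_le' tendsto_const_nhds
      (tendsto_rpow_neg_atTop (by linarith : 0 < 2 * μ + c)) ?_ ?_
    · filter_upwards [eventually_ge_atTop 0] with t ht using scaledKernel_nonneg μ η n β ht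
    · filter_upwards [eventually_ge_atTop 1] with t ht
      rw [neg_add']
      exact scaledKernel_le hη n hc hβ ht
  have hk'_int : IntegrableOn k' (Ioi 1) :=
    integrableOn_Ioi_deriv_of_nonpos' hkd hk'_nonpos hk_lim
  have hk'_eq : ∫ t in Ioi (1 : ℝ), k' t = -1 := by
    rw [integral_Ioi_of_hasDerivAt_of_nonpos' hkd hk'_nonpos hk_lim, hk, scaledKernel_one, zero_sub]
  have he_norm : ∀ t, ‖e t‖ = 1 := fun t => Complex.norm_exp_ofReal_mul_I _
  have he_cont : Continuous e := by fun_prop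
  have hed : ∀ t, HasDerivAt e (e t * (-(n * β : ℂ) * Complex.I)) t := fun t => by
    have h : HasDerivAt (fun s : ℝ => (n : ℝ) * (β * (1 - s))) ((n : ℝ) * (β * (-1))) t :=
      (((hasDerivAt_id t).const_sub 1).const_mul β).const_mul (n : ℝ)
    refine ((h.ofReal_comp.mul_const Complex.I).cexp).congr_deriv ?_
    simp only [he]
    push_cast
    ring
  have hke_int : IntegrableOn (fun t => (k t : ℂ) * e t) (Ioi 1) := by
    have := integrableOn_scaledIntegrand hη n hc hcμ (f := fun _ => 1) continuousOn_const hβ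
      (M := 1) fun b _ => by simp
    exact this.congr (Eventually.of_forall fun t => by
      simp only [scaledIntegrand, mul_one, hk, he])
  have hk'e_int : IntegrableOn (fun t => (k' t : ℂ) * e t) (Ioi 1) := by
    refine hk'_int.norm.mono' (hk'_int.ofReal.aestronglyMeasurable.mul
      he_cont.aestronglyMeasurable) (Eventually.of_forall fun t => ?_)
    rw [norm_mul, he_norm, mul_one, Complex.norm_real]
  have hlim : Tendsto (fun t => (k t : ℂ) * e t) atTop (𝓝 0) := by
    rw [tendsto_zero_iff_norm_tendsto_zero]
    simpa [he_norm] using hk_lim.norm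
  have hftc := integral_Ioi_of_hasDerivAt_of_tendsto' (a := 1)
    (fun t ht => (hkd t ht).ofReal_comp.mul (hed t))
    (hk'e_int.add (((hke_int.mul_const (-(n * β : ℂ) * Complex.I))).congr
      (Eventually.of_forall fun t => by simp only [mul_assoc]))) hlim
  have he1 : (k 1 : ℂ) * e 1 = 1 := by simp [hk, he, scaledKernel_one]
  have hsplit : ∫ t in Ioi (1 : ℝ), ((k' t : ℂ) * e t + k t * (e t * (-(n * β : ℂ) * Complex.I))) =
      (∫ t in Ioi (1 : ℝ), (k' t : ℂ) * e t) +
        (∫ t in Ioi (1 : ℝ), (k t : ℂ) * e t) * (-(n * β : ℂ) * Complex.I) := by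
    rw [← MeasureTheory.integral_mul_const, ← MeasureTheory.integral_add hk'e_int
      (hke_int.mul_const _)]
    simp only [mul_assoc]
  have hL : Lplus μ η n (fun _ => 1) β = ∫ t in Ioi (1 : ℝ), (k t : ℂ) * e t := by
    rw [Lplus_eq_integral _ _ _ _ hβ]
    simp only [scaledIntegrand, mul_one, hk, he]
  have hmain : Lplus μ η n (fun _ => 1) β * ((n * β : ℂ) * Complex.I) =
      1 + ∫ t in Ioi (1 : ℝ), (k' t : ℂ) * e t := by
    have hftc' : (∫ t in Ioi (1 : ℝ), (k' t : ℂ) * e t) +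
        (∫ t in Ioi (1 : ℝ), (k t : ℂ) * e t) * (-(n * β : ℂ) * Complex.I) = -1 := by
      rw [← hsplit]
      exact hftc.trans (by rw [Pi.mul_apply, he1, zero_sub])
    rw [hL]
    linear_combination -hftc'
  have hbound : ‖∫ t in Ioi (1 : ℝ), (k' t : ℂ) * e t‖ ≤ 1 := by
    refine (MeasureTheory.norm_integral_le_of_norm_le hk'_int.neg ?_).trans_eq (by
      simp only [Pi.neg_apply]
      rw [MeasureTheory.integral_neg, hk'_eq, neg_neg])
    filter_upwards [ae_restrict_mem measurableSet_Ioi] with t ht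
    rw [norm_mul, he_norm, mul_one, Complex.norm_real, Real.norm_of_nonpos (hk'_nonpos t ht)]
    rfl
  have hnorm : ‖Lplus μ η n (fun _ => 1) β‖ * (|(n : ℝ)| * β) ≤ 2 := by
    have h := congrArg norm hmain
    rw [norm_mul, norm_mul, norm_mul, Complex.norm_I, mul_one, Complex.norm_real,
      Complex.norm_intCast, Real.norm_of_nonneg hβ.le] at h
    rw [h]
    calc _ ≤ ‖(1 : ℂ)‖ + _ := norm_add_le _ _
      _ ≤ 2 := by rw [norm_one]; linarith
  have hn0 : 0 < |(n : ℝ)| := abs_pos.mpr (by exact_mod_cast hn)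
  rw [le_div_iff₀ hβ, ← div_eq_mul_inv, le_div_iff₀ hn0]
  linarith

theorem exists_norm_le_of_tendsto_atTop {f : ℝ → ℂ} {L : ℂ} {a : ℝ} (hf : ContinuousOn f (Ici a))
    (hL : Tendsto f atTop (𝓝 L)) : ∃ M, ∀ b, a ≤ b → ‖f b‖ ≤ M := by
  obtain ⟨B, hB⟩ := eventually_atTop.mp
    (hL.norm.eventually (eventually_le_nhds (lt_add_one ‖L‖)))
  obtain ⟨M, hM⟩ := (isCompact_Icc (a := a) (b := B)).exists_bound_of_continuousOn
    (hf.mono Icc_subset_Ici_self)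
  refine ⟨max M (‖L‖ + 1), fun b hb => ?_⟩
  rcases le_total b B with h | h
  · exact (hM b ⟨hb, h⟩).trans (le_max_left _ _)
  · exact (hB b h).trans (le_max_right _ _)

theorem continuousOn_Lplus {μ : ℝ} {η : ℝ → ℝ} (hη : Continuous η) (n : ℤ) {c : ℝ}
    (hc : ∀ b, c ≤ aFun μ η n b) (hcμ : 1 < 2 * μ + c) {f : ℝ → ℂ}
    (hf : ContinuousOn f (Ici 0)) {M : ℝ} (hM : ∀ b, 0 ≤ b → ‖f b‖ ≤ M) :
    ContinuousOn (Lplus μ η n f) (Ioi 0) := by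
  have h : ContinuousOn (fun β => ∫ t in Ioi (1 : ℝ), scaledIntegrand μ η n f β t) (Ioi 0) := by
    refine continuousOn_of_dominated (bound := fun t => t ^ (-(2 * μ) - c) * M) (fun β hβ =>
      (continuousOn_scaledIntegrand_right hη n hf hβ).aestronglyMeasurable measurableSet_Ioi)
      (fun β hβ => ?_)
      ((integrableOn_Ioi_rpow_of_lt (by linarith : -(2 * μ) - c < -1) one_pos).mul_const M) ?_
    · filter_upwards [ae_restrict_mem measurableSet_Ioi] with t ht
      exact norm_scaledIntegrand_le hη n hc hβ (fun b hb => hM b ((le_of_lt hβ).trans hb))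
        (le_of_lt ht)
    · filter_upwards [ae_restrict_mem measurableSet_Ioi] with t ht
      exact continuousOn_scaledIntegrand_left hη n hf (zero_lt_one.trans ht)
  exact h.congr fun β hβ => Lplus_eq_integral μ η n f hβ

theorem tendsto_Lplus_zero {μ : ℝ} {η : ℝ → ℝ} (hμ : 0 ≤ μ) (hη : Continuous η)
    (hη0 : ∀ β ≤ 1, η β = 0) (n : ℤ) {c : ℝ}
    (hc : ∀ b, c ≤ aFun μ η n b) (hcμ : 1 < 2 * μ + c) {f : ℝ → ℂ}
    (hf : ContinuousOn f (Ici 0)) {M : ℝ} (hM : ∀ b, 0 ≤ b → ‖f b‖ ≤ M) :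
    Tendsto (Lplus μ η n f) (𝓝[>] 0)
      (𝓝 (f 0 / ((|(n : ℝ)| * μ + 2 * μ - 1 : ℝ) : ℂ))) := by
  set p : ℝ := -(2 * μ) - |(n : ℝ)| * μ with hp
  have hcn : c ≤ |(n : ℝ)| * μ :=
    (hc 0).trans_eq (aFun_eq_of_eta_eq_zero hμ n (hη0 0 zero_le_one))
  have hp1 : p < -1 := by linarith
  have hlim : ∫ t in Ioi (1 : ℝ), ((t ^ p : ℝ) : ℂ) * f 0 =
      f 0 / ((|(n : ℝ)| * μ + 2 * μ - 1 : ℝ) : ℂ) := by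
    rw [MeasureTheory.integral_mul_const, integral_complex_ofReal,
      integral_Ioi_rpow_of_lt hp1 one_pos, Real.one_rpow,
      show p + 1 = -(|(n : ℝ)| * μ + 2 * μ - 1) by rw [hp]; ring, neg_div_neg_eq,
      Complex.ofReal_div, Complex.ofReal_one, one_div_mul_eq_div]
  have h : Tendsto (fun β => ∫ t in Ioi (1 : ℝ), scaledIntegrand μ η n f β t) (𝓝[>] 0)
      (𝓝 (∫ t in Ioi (1 : ℝ), ((t ^ p : ℝ) : ℂ) * f 0)) := by
    refine tendsto_integral_filter_of_dominated_convergence (fun t => t ^ (-(2 * μ) - c) * M)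
      ?_ ?_ ((integrableOn_Ioi_rpow_of_lt (by linarith : -(2 * μ) - c < -1) one_pos).mul_const M) ?_
    · filter_upwards [self_mem_nhdsWithin] with β hβ
      exact (continuousOn_scaledIntegrand_right hη n hf hβ).aestronglyMeasurable measurableSet_Ioi
    · filter_upwards [self_mem_nhdsWithin] with β hβ
      filter_upwards [ae_restrict_mem measurableSet_Ioi] with t ht
      exact norm_scaledIntegrand_le hη n hc hβ (fun b hb => hM b ((le_of_lt hβ).trans hb))
        (le_of_lt ht)
    · filter_upwards [ae_restrict_mem measurableSet_Ioi] with t ht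
      have ht1 : (1 : ℝ) < t := ht
      have ht0 : (0 : ℝ) < t := zero_lt_one.trans ht1
      have hmul : Tendsto (fun β : ℝ => β * t) (𝓝[>] 0) (𝓝 0) := by
        have : Tendsto (fun β : ℝ => β * t) (𝓝 0) (𝓝 (0 * t)) := tendsto_id.mul_const t
        rw [zero_mul] at this
        exact this.mono_left nhdsWithin_le_nhds
      have hker : Tendsto (fun β => scaledKernel μ η n β t) (𝓝[>] 0) (𝓝 (t ^ p)) := by
        refine tendsto_const_nhds.congr' ?_
        filter_upwards [self_mem_nhdsWithin, hmul.eventually (eventually_le_nhds one_pos)]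
          with β hβ hβt
        rw [scaledKernel, WFun_div_WFun_eq hμ hη hη0 n hβ ht1.le hβt, ← Real.rpow_add ht0, hp,
          sub_eq_add_neg]
      have hexp : Tendsto
          (fun β : ℝ => Complex.exp (((n : ℝ) * (β * (1 - t)) : ℝ) * Complex.I))
          (𝓝[>] 0) (𝓝 1) := by
        have : Continuous
            (fun β : ℝ => Complex.exp (((n : ℝ) * (β * (1 - t)) : ℝ) * Complex.I)) := by
          fun_prop
        have := this.tendsto 0
        simp only [zero_mul, mul_zero, Complex.ofReal_zero, Complex.exp_zero] at this
        exact this.mono_left nhdsWithin_le_nhds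
      have hft : Tendsto (fun β => f (β * t)) (𝓝[>] 0) (𝓝 (f 0)) := by
        refine (hf 0 self_mem_Ici).tendsto.comp (tendsto_nhdsWithin_iff.mpr ⟨hmul, ?_⟩)
        filter_upwards [self_mem_nhdsWithin] with β hβ
        exact (mul_pos hβ ht0).le
      have := (((Complex.continuous_ofReal.tendsto _).comp hker).mul hexp).mul hft
      rw [mul_one] at this
      exact this
  rw [← hlim]
  refine h.congr' ?_
  filter_upwards [self_mem_nhdsWithin] with β hβ using (Lplus_eq_integral μ η n f hβ).symm

theorem tendsto_Lplus_atTop {μ : ℝ} {η : ℝ → ℝ} (hμ : 0 ≤ μ) (hη : Continuous η) {n : ℤ}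
    (hn : n ≠ 0) {c : ℝ} (hc : ∀ b, c ≤ aFun μ η n b) (hcμ : 1 < 2 * μ + c) {f : ℝ → ℂ} {L : ℂ}
    (hf : ContinuousOn f (Ici 0)) (hL : Tendsto f atTop (𝓝 L)) :
    Tendsto (Lplus μ η n f) atTop (𝓝 0) := by
  obtain ⟨M, hM⟩ := exists_norm_le_of_tendsto_atTop hf hL
  have h₁ : Tendsto (Lplus μ η n fun b => f b - L) atTop (𝓝 0) := by
    rw [Metric.tendsto_atTop] at hL ⊢
    intro ε hε
    have hpos : 0 < 2 * μ + c - 1 := by linarith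
    obtain ⟨B, hB⟩ := hL (ε / 2 * (2 * μ + c - 1)) (by positivity)
    refine ⟨max B 1, fun β hβ => ?_⟩
    rw [dist_zero_right]
    refine (norm_Lplus_le hη n hc hcμ (zero_lt_one.trans_le ((le_max_right _ _).trans hβ))
      (M := ε / 2 * (2 * μ + c - 1)) fun b hb => ?_).trans_lt ?_
    · rw [← dist_eq_norm]
      exact (hB b (((le_max_left _ _).trans hβ).trans hb)).le
    · rw [mul_div_cancel_right₀ _ hpos.ne']
      linarith
  have h₂ : Tendsto (Lplus μ η n fun _ => 1) atTop (𝓝 0) := by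
    refine squeeze_zero_norm' (a := fun β => 2 * |(n : ℝ)|⁻¹ / β) ?_
      (tendsto_const_nhds.div_atTop tendsto_id)
    filter_upwards [eventually_gt_atTop 0] with β hβ
    exact norm_Lplus_one_le hμ hη hn hc hcμ hβ
  have h := h₁.add (h₂.const_mul L)
  rw [mul_zero, add_zero] at h
  refine h.congr' ?_
  filter_upwards [eventually_gt_atTop 0] with β hβ
  exact (Lplus_eq_add hη n hc hcμ hf hβ (fun b hb => hM b (hβ.le.trans hb)) L).symm

/-- Boundedness of `L_{n,+}^{-1} : 𝒞 → 𝒞` and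
`L_{n,+}^{-1} : 𝒞^δ → 𝒞^δ_0` with operator norm `≲ |n|⁻¹`, uniformly in `n ≠ 0`. -/
theorem stmt_7 (μ δ : ℝ) (hμ : 1 < μ)
    (hδ0 : 0 < δ)
    (hδ1 : δ < min (Real.sqrt (4 * μ ^ 2 - 2 * μ + 1) - 2 * μ + 1) 1)
    (η : ℝ → ℝ) (hη_smooth : ContDiff ℝ (⊤ : ℕ∞) η)
    (hη_range : ∀ β, 0 ≤ η β ∧ η β ≤ 1)
    (hη0 : ∀ β : ℝ, β ≤ 1 → η β = 0) (hη1 : ∀ β : ℝ, 2 ≤ β → η β = 1) :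
    (∀ n : ℤ, n ≠ 0 → ∀ (f : ℝ → ℂ) (L : ℂ),
      ContinuousOn f (Ici 0) → Tendsto f atTop (nhds L) →
      ContinuousOn (Lplus μ η n f) (Ioi 0) ∧
      Tendsto (Lplus μ η n f) (nhdsWithin 0 (Ioi 0))
        (nhds (f 0 / ((|(n : ℝ)| * μ + 2 * μ - 1 : ℝ) : ℂ))) ∧
      Tendsto (Lplus μ η n f) atTop (nhds 0)) ∧
    (∃ C : ℝ, 0 < C ∧ ∀ n : ℤ, n ≠ 0 → ∀ (f : ℝ → ℂ) (L : ℂ),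
      ContinuousOn f (Ici 0) → Tendsto f atTop (nhds L) →
      BddAbove (Set.range fun β : Ioi (0 : ℝ) => (β : ℝ) ^ δ * ‖f (β : ℝ) - L‖) →
      BddAbove (Set.range fun β : Ioi (0 : ℝ) => (β : ℝ) ^ δ * ‖Lplus μ η n f (β : ℝ)‖) ∧
      supNIoi (Lplus μ η n f) + hoel δ (Lplus μ η n f) 0 ≤
        C * |(n : ℝ)|⁻¹ * (supN f + hoel δ f L)) := by
  have hη : Continuous η := hη_smooth.continuous
  have hμ0 : 0 ≤ μ := by linarith
  have hlow : ∀ n : ℤ, n ≠ 0 → ∀ b, |(n : ℝ)| * (μ - 1) ≤ aFun μ η n b := fun n hn b =>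
    le_aFun hμ hn (hη_range b).2
  have hlow1 : ∀ n : ℤ, 1 < 2 * μ + |(n : ℝ)| * (μ - 1) := fun n => by
    have : 0 ≤ |(n : ℝ)| * (μ - 1) := mul_nonneg (abs_nonneg _) (by linarith)
    linarith
  refine ⟨fun n hn f L hf hL => ?_, 2 / (μ - 1) + 2, ?_, fun n hn f L hf hL hbdd => ?_⟩
  · obtain ⟨M, hM⟩ := exists_norm_le_of_tendsto_atTop hf hL
    exact ⟨continuousOn_Lplus hη n (hlow n hn) (hlow1 n) hf hM,
      tendsto_Lplus_zero hμ0 hη hη0 n (hlow n hn) (hlow1 n) hf hM,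
      tendsto_Lplus_atTop hμ0 hη hn (hlow n hn) (hlow1 n) hf hL⟩
  · have : 0 < μ - 1 := by linarith
    positivity
  obtain ⟨M, hM⟩ := exists_norm_le_of_tendsto_atTop hf hL
  set S := supN f
  set H := hoel δ f L
  set N := |(n : ℝ)|⁻¹ with hN
  set D := (μ - 1)⁻¹ with hD
  have hμ1 : 0 < μ - 1 := by linarith
  have hn0 : 0 < |(n : ℝ)| := abs_pos.mpr (by exact_mod_cast hn)
  have hN0 : 0 < N := inv_pos.mpr hn0
  have hD0 : 0 < D := inv_pos.mpr hμ1
  have hfS : ∀ b, 0 ≤ b → ‖f b‖ ≤ S := fun b hb =>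
    le_ciSup (f := fun β : Ici (0 : ℝ) => ‖f (β : ℝ)‖)
      ⟨M, by rintro _ ⟨β, rfl⟩; exact hM β β.2⟩ ⟨b, hb⟩
  have hS0 : 0 ≤ S := (norm_nonneg _).trans (hfS 0 le_rfl)
  have hLS : ‖L‖ ≤ S := le_of_tendsto hL.norm (by
    filter_upwards [eventually_ge_atTop 0] with b hb using hfS b hb)
  have hfH : ∀ b, 0 < b → b ^ δ * ‖f b - L‖ ≤ H := fun b hb =>
    le_ciSup (f := fun β : Ioi (0 : ℝ) => (β : ℝ) ^ δ * ‖f (β : ℝ) - L‖) hbdd ⟨b, hb⟩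
  have hH0 : 0 ≤ H := (mul_nonneg (Real.rpow_nonneg zero_le_one _) (norm_nonneg _)).trans
    (hfH 1 one_pos)
  have hbound : ∀ (g : ℝ → ℂ) (K β : ℝ), 0 < β → 0 ≤ K → (∀ b, β ≤ b → ‖g b‖ ≤ K) →
      ‖Lplus μ η n g β‖ ≤ K * (N * D) := fun g K β hβ hK hg => by
    refine (norm_Lplus_le hη n (hlow n hn) (hlow1 n) hβ hg).trans ?_
    rw [hN, hD, ← mul_inv, ← div_eq_mul_inv]
    gcongr
    linarith
  have hsup : ∀ β : ℝ, 0 < β → ‖Lplus μ η n f β‖ ≤ S * (N * D) := fun β hβ =>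
    hbound f S β hβ hS0 fun b hb => hfS b (hβ.le.trans hb)
  have hone : ∀ β : ℝ, 0 < β → β ^ δ * ‖Lplus μ η n (fun _ => 1) β‖ ≤ N * (D + 2) := by
    intro β hβ
    rcases le_total β 1 with h | h
    · have h₁ := hbound (fun _ => 1) 1 β hβ zero_le_one (by simp)
      calc _ ≤ 1 * (1 * (N * D)) :=
            mul_le_mul (Real.rpow_le_one hβ.le h hδ0.le) h₁ (norm_nonneg _) zero_le_one
        _ ≤ N * (D + 2) := by nlinarith
    · have h₁ := norm_Lplus_one_le hμ0 hη hn (hlow n hn) (hlow1 n) hβ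
      have h₂ : β ^ δ ≤ β := by
        simpa using Real.rpow_le_rpow_of_exponent_le h (hδ1.le.trans (min_le_right _ _))
      calc _ ≤ β * (2 * N / β) := mul_le_mul h₂ h₁ (norm_nonneg _) hβ.le
        _ = 2 * N := by field_simp
        _ ≤ N * (D + 2) := by nlinarith [mul_pos hN0 hD0]
  have hwt : ∀ β : ℝ, 0 < β →
      β ^ δ * ‖Lplus μ η n f β‖ ≤ H * (N * D) + S * (N * (D + 2)) := by
    intro β hβ
    have hβδ : 0 < β ^ δ := Real.rpow_pos_of_pos hβ δ
    have h₁ := hbound (fun b => f b - L) (H / β ^ δ) β hβ (by positivity) fun b hb => by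
      rw [le_div_iff₀ hβδ, mul_comm]
      refine le_trans ?_ (hfH b (hβ.trans_le hb))
      gcongr
    have h₂ : β ^ δ * ‖Lplus μ η n (fun b => f b - L) β‖ ≤ H * (N * D) :=
      (mul_le_mul_of_nonneg_left h₁ hβδ.le).trans_eq (by field_simp)
    rw [Lplus_eq_add hη n (hlow n hn) (hlow1 n) hf hβ (fun b hb => hM b (hβ.le.trans hb)) L]
    calc _ ≤ β ^ δ * (‖Lplus μ η n (fun b => f b - L) β‖ +
            ‖L‖ * ‖Lplus μ η n (fun _ => 1) β‖) := by
          gcongr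
          exact (norm_add_le _ _).trans_eq (by rw [norm_mul])
      _ = β ^ δ * ‖Lplus μ η n (fun b => f b - L) β‖ +
            ‖L‖ * (β ^ δ * ‖Lplus μ η n (fun _ => 1) β‖) := by ring
      _ ≤ _ := add_le_add h₂ (mul_le_mul hLS (hone β hβ) (by positivity) hS0)
  have : Nonempty (Ioi (0 : ℝ)) := ⟨⟨1, mem_Ioi.mpr one_pos⟩⟩
  refine ⟨⟨_, by rintro _ ⟨β, rfl⟩; exact hwt β β.2⟩, ?_⟩
  have h₁ : supNIoi (Lplus μ η n f) ≤ S * (N * D) := ciSup_le fun β => hsup β β.2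
  have h₂ : hoel δ (Lplus μ η n f) 0 ≤ H * (N * D) + S * (N * (D + 2)) :=
    ciSup_le fun β => by
      rw [sub_zero]
      exact hwt β β.2
  rw [div_eq_mul_inv]
  nlinarith [mul_nonneg hH0 hN0.le, mul_nonneg (mul_nonneg hH0 hN0.le) hD0.le]
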